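/- For every fixed real μ ≥ 1/2, the function μ̃ ↦ F(μ, μ̃) := (1 − 4μ̃·[√(4μ² − 1) + μ̃ − 2μ(1 + 2μ̃·ξ(μ))])^(−1/4), with ξ(μ) := 2μ − √(4μ² − 1), tends to 0 as μ̃ → ∞. In particular, for any finite teleportation energy μ the fidelity between a TMSV state and its teleported version vanishes in the limit of infinite input energy. -/

import Mathlib

/-- Added noise of the μ-energy Braunstein–Kimble teleportation protocol. -/
noncomputable def xiBK (μ : ℝ) : ℝ := 2*μ - Real.sqrt (4*μ^2 - 1)

/-- Fidelity between a TMSV state of energy μ̃ and its output under the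
μ-energy BK teleportation channel. -/
noncomputable def FBK (μ μt : ℝ) : ℝ :=
  (1 - 4*μt*(Real.sqrt (4*μ^2 - 1) + μt - 2*μ*(1 + 2*μt*xiBK μ))) ^ (-(1/4 : ℝ))

theorem xiBK_pos {μ : ℝ} (hμ : 1/2 ≤ μ) : 0 < xiBK μ := by
  have h : Real.sqrt (4*μ^2 - 1) < 2*μ :=
    (Real.sqrt_lt' (by linarith)).2 (by nlinarith)
  exact sub_pos.2 h

theorem FBK_eq {μ : ℝ} (hμ : 1/2 ≤ μ) (μt : ℝ) :
    FBK μ μt = ((1 + 2*xiBK μ*μt)^2) ^ (-(1/4 : ℝ)) := by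
  have h : Real.sqrt (4*μ^2 - 1) ^ 2 = 4*μ^2 - 1 := Real.sq_sqrt (by nlinarith)
  unfold FBK xiBK
  congr 1
  linear_combination (-4*μt^2) * h

theorem bk_fidelity_tendsto_zero (μ : ℝ) (hμ : 1/2 ≤ μ) :
    Filter.Tendsto (fun μt : ℝ => FBK μ μt) Filter.atTop (nhds 0) := by
  simp only [FBK_eq hμ]
  have h : Filter.Tendsto (fun μt : ℝ => 1 + 2*xiBK μ*μt) Filter.atTop Filter.atTop :=
    Filter.tendsto_atTop_add_const_left _ _
      (Filter.tendsto_id.const_mul_atTop (mul_pos two_pos (xiBK_pos hμ)))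
  exact (tendsto_rpow_neg_atTop (by norm_num : (0 : ℝ) < 1/4)).comp
    ((Filter.tendsto_pow_atTop two_ne_zero).comp h)
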